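/- arXiv:1512.00393 — 18 statements merged into one kernel-verified Lean document; each statement's English description precedes it below -/
import Mathlib

section
/- Let n be an integer and let k, δ, δ', λ, f be real numbers with δ ≠ 0 and f ≠ 0. Suppose that for every v ∈ ℝ, with w = Real.sqrt (v² + δ²), the identity f²·w^(2n+4) + f·(k·v² + δ'·v + δ²·(k+λ))·w^(n+1) − δ² = 0 holds. Then exactly one of the following occurs: (a) n = −1, f = −k, δ' = 0 and k·λ + 1 = 0; (b) n = −2, k = 0, δ' = 0, λ = 0 and (f = δ or f = −δ); (c) n = −3, δ' = 0, k·λ + 1 = 0, k ≠ 0 and f·k = δ². -/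
open Polynomial in
theorem Polynomial.eq_zero_of_eval_eq_zero_of_le {p : ℝ[X]} (r : ℝ)
    (h : ∀ x, r ≤ x → p.eval x = 0) : p = 0 :=
  p.eq_zero_of_infinite_isRoot ((Set.Ici_infinite r).mono h)

open Polynomial in
/-- The exponents `2 * m + 2`, `m + 2`, `m`, `0` of the sum coincide (in pairs) only if `m = 0`. -/
theorem eq_zero_and_add_eq_zero_of_forall_le {m : ℕ} {a b c d r : ℝ} (ha : a ≠ 0)
    (h : ∀ x, r ≤ x → a * x ^ (2 * m + 2) + b * x ^ (m + 2) + c * x ^ m + d = 0) :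
    m = 0 ∧ a + b = 0 ∧ c + d = 0 := by
  have hp : C a * X ^ (2 * m + 2) + C b * X ^ (m + 2) + C c * X ^ m + C d = 0 :=
    eq_zero_of_eval_eq_zero_of_le r fun x hx => by simpa using h x hx
  have hm : m = 0 := by
    by_contra hm
    have h₁ := congrArg (coeff · (2 * m + 2)) hp
    simp only [coeff_add, coeff_C_mul, coeff_X_pow, coeff_C, coeff_zero] at h₁
    rw [if_pos trivial, if_neg (by lia), if_neg (by lia), if_neg (by lia)] at h₁
    exact ha (by linarith)
  subst hm
  have h₂ := congrArg (coeff · 2) hp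
  have h₀ := congrArg (coeff · 0) hp
  simp only [coeff_add, coeff_C_mul, coeff_X_pow, coeff_C, coeff_zero] at h₂ h₀
  norm_num at h₂ h₀
  exact ⟨rfl, h₂, h₀⟩

open Polynomial in
theorem eq_zero_of_forall_le_quadratic {a b c r : ℝ}
    (h : ∀ x, r ≤ x → a * x ^ 2 + b * x + c = 0) : a = 0 ∧ b = 0 ∧ c = 0 := by
  have hp : C a * X ^ 2 + C b * X + C c = 0 :=
    eq_zero_of_eval_eq_zero_of_le r fun x hx => by simpa using h x hx
  have h₂ := congrArg (coeff · 2) hp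
  have h₁ := congrArg (coeff · 1) hp
  have h₀ := congrArg (coeff · 0) hp
  simp [coeff_X, coeff_C] at h₂ h₁ h₀
  exact ⟨h₂, h₁, h₀⟩

theorem stmt_0 (n : ℤ) (k δ δ' lam f : ℝ) (hδ : δ ≠ 0) (hf : f ≠ 0)
    (h : ∀ v : ℝ,
      f ^ 2 * Real.sqrt (v ^ 2 + δ ^ 2) ^ (2 * n + 4)
        + f * (k * v ^ 2 + δ' * v + δ ^ 2 * (k + lam))
            * Real.sqrt (v ^ 2 + δ ^ 2) ^ (n + 1)
        - δ ^ 2 = 0) :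
    ((n = -1 ∧ f = -k ∧ δ' = 0 ∧ k * lam + 1 = 0)
        ∧ ¬(n = -2 ∧ k = 0 ∧ δ' = 0 ∧ lam = 0 ∧ (f = δ ∨ f = -δ))
        ∧ ¬(n = -3 ∧ δ' = 0 ∧ k * lam + 1 = 0 ∧ k ≠ 0 ∧ f * k = δ ^ 2))
    ∨ ((n = -2 ∧ k = 0 ∧ δ' = 0 ∧ lam = 0 ∧ (f = δ ∨ f = -δ))
        ∧ ¬(n = -1 ∧ f = -k ∧ δ' = 0 ∧ k * lam + 1 = 0)
        ∧ ¬(n = -3 ∧ δ' = 0 ∧ k * lam + 1 = 0 ∧ k ≠ 0 ∧ f * k = δ ^ 2))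
    ∨ ((n = -3 ∧ δ' = 0 ∧ k * lam + 1 = 0 ∧ k ≠ 0 ∧ f * k = δ ^ 2)
        ∧ ¬(n = -1 ∧ f = -k ∧ δ' = 0 ∧ k * lam + 1 = 0)
        ∧ ¬(n = -2 ∧ k = 0 ∧ δ' = 0 ∧ lam = 0 ∧ (f = δ ∨ f = -δ))) := by
  have hδ' : δ' = 0 := by
    have hw : (0 : ℝ) < √(1 ^ 2 + δ ^ 2) := by positivity
    have h₁ := h 1
    have h₂ := h (-1)
    rw [neg_one_sq, ← one_pow 2] at h₂
    have h₃ : f * δ' * √(1 ^ 2 + δ ^ 2) ^ (n + 1) = 0 := by linear_combination (h₁ - h₂) / 2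
    exact (mul_eq_zero_iff_left hf).mp ((mul_eq_zero_iff_right (zpow_pos hw _).ne').mp h₃)
  have hx : ∀ x, |δ| ≤ x →
      0 < x ∧ f ^ 2 * x ^ (2 * n + 4) + f * (k * x ^ 2 + δ ^ 2 * lam) * x ^ (n + 1) - δ ^ 2 = 0 := by
    intro x hx
    have hx₀ : 0 < x := (abs_pos.mpr hδ).trans_le hx
    have hsq : √(x ^ 2 - δ ^ 2) ^ 2 = x ^ 2 - δ ^ 2 :=
      Real.sq_sqrt (sub_nonneg.mpr (sq_le_sq.mpr (hx.trans (le_abs_self x))))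
    have hv := h √(x ^ 2 - δ ^ 2)
    rw [hsq, sub_add_cancel, Real.sqrt_sq hx₀.le, hδ'] at hv
    exact ⟨hx₀, by linear_combination hv⟩
  have hδ₂ : δ ^ 2 ≠ 0 := pow_ne_zero 2 hδ
  have hf₂ : f ^ 2 ≠ 0 := pow_ne_zero 2 hf
  obtain hn | rfl | hn : -1 ≤ n ∨ n = -2 ∨ n ≤ -3 := by lia
  · obtain ⟨m, rfl⟩ : ∃ m : ℕ, n = m - 1 := ⟨(n + 1).toNat, by lia⟩
    obtain ⟨rfl, hk, hl⟩ := eq_zero_and_add_eq_zero_of_forall_le (m := m) (b := f * k)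
        (c := f * δ ^ 2 * lam) (d := -δ ^ 2) (r := |δ|) hf₂ fun x hr => by
      obtain ⟨-, e⟩ := hx x hr
      rw [show 2 * ((m : ℤ) - 1) + 4 = (2 * m + 2 : ℕ) by push_cast; ring, sub_add_cancel,
        zpow_natCast, zpow_natCast] at e
      linear_combination e
    have hfk : f = -k := mul_left_cancel₀ hf (by linear_combination hk)
    have hkl : k * lam + 1 = 0 := mul_left_cancel₀ hδ₂ (by rw [hfk] at hl; linear_combination -hl)
    exact Or.inl ⟨⟨by simp, hfk, hδ', hkl⟩, by simp, by simp⟩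
  · obtain ⟨hk, hfδ, hl⟩ := eq_zero_of_forall_le_quadratic (a := f * k) (b := f ^ 2 - δ ^ 2)
        (c := f * δ ^ 2 * lam) (r := |δ|) fun x hr => by
      obtain ⟨hx₀, e⟩ := hx x hr
      norm_num at e
      field_simp at e
      linear_combination e
    exact Or.inr <| Or.inl ⟨⟨rfl, by simpa [hf] using hk, hδ', by simpa [hf, hδ] using hl,
      sq_eq_sq_iff_eq_or_eq_neg.mp (sub_eq_zero.mp hfδ)⟩, by simp, by simp⟩
  · obtain ⟨m, rfl⟩ : ∃ m : ℕ, n = -3 - m := ⟨(-3 - n).toNat, by lia⟩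
    obtain ⟨rfl, hk, hl⟩ := eq_zero_and_add_eq_zero_of_forall_le (m := m) (b := f * k)
        (c := f * δ ^ 2 * lam) (d := f ^ 2) (r := |δ|) (neg_ne_zero.mpr hδ₂) fun x hr => by
      obtain ⟨hx₀, e⟩ := hx x hr
      rw [show 2 * (-3 - (m : ℤ)) + 4 = -(2 * m + 2 : ℕ) by push_cast; ring,
        show -3 - (m : ℤ) + 1 = -(m + 2 : ℕ) by push_cast; ring,
        zpow_neg, zpow_neg, zpow_natCast, zpow_natCast] at e
      have e₁ : x ^ (2 * m + 2) * (x ^ (2 * m + 2))⁻¹ = 1 := mul_inv_cancel₀ (by positivity)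
      have e₂ : x ^ (m + 2) * (x ^ (m + 2))⁻¹ = 1 := mul_inv_cancel₀ (by positivity)
      linear_combination x ^ (2 * m + 2) * e - f ^ 2 * e₁
        - f * (k * x ^ 2 + δ ^ 2 * lam) * x ^ m * e₂
    have hfk : f * k = δ ^ 2 := by linear_combination hk
    have hfl : f = -(δ ^ 2 * lam) := mul_left_cancel₀ hf (by linear_combination hl)
    have hkl : k * lam + 1 = 0 := mul_left_cancel₀ hδ₂ (by rw [hfl] at hfk; linear_combination -hfk)
    exact Or.inr <| Or.inr ⟨⟨by simp, hδ', hkl, right_ne_zero_of_mul (hfk ▸ hδ₂), hfk⟩,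
      by simp, by simp⟩
end

section
/- Let k, δ, δ', λ be real numbers with δ ≠ 0, and let k₁, k₂ : ℝ → ℝ be functions such that for every v ∈ ℝ, with w = Real.sqrt (v² + δ²): (i) k₁(v)·k₂(v) = −δ²/w⁴, (ii) k₁(v) + k₂(v) = −(k·v² + δ'·v + δ²·(k+λ))/w³, and (iii) δ²·k₁(v)³ + k⁴·k₂(v) = 0. Then k ≠ 0, δ' = 0 and k·λ + 1 = 0. -/
/-- If `a`, `b` have product `-δ² / w⁴`, sum `-S / w³` and satisfy `δ² a³ + k⁴ b = 0`,
then `k S = ± (k² w² - δ²)`. -/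
lemma sq_mul_eq_of_curvature_relation {k δ w a b S : ℝ} (hδ : δ ≠ 0) (hk : k ≠ 0) (hw : w ≠ 0)
    (hK : a * b = -δ ^ 2 / w ^ 4) (hH : a + b = -S / w ^ 3)
    (hrel : δ ^ 2 * a ^ 3 + k ^ 4 * b = 0) :
    (k * S) ^ 2 = (k ^ 2 * w ^ 2 - δ ^ 2) ^ 2 := by
  rw [eq_div_iff (pow_ne_zero _ hw)] at hK hH
  have haw : (a * w) ^ 2 = k ^ 2 := by
    have h4 : δ ^ 2 * ((a * w) ^ 2) ^ 2 = δ ^ 2 * (k ^ 2) ^ 2 := by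
      linear_combination a * w ^ 4 * hrel - k ^ 4 * hK
    exact (sq_eq_sq₀ (sq_nonneg _) (sq_nonneg _)).1 (mul_left_cancel₀ (pow_ne_zero 2 hδ) h4)
  have hb : k ^ 2 * b * w ^ 2 = -δ ^ 2 * a := by
    apply mul_left_cancel₀ (pow_ne_zero 2 hk)
    linear_combination w ^ 2 * hrel - δ ^ 2 * a * haw
  have hS : k ^ 2 * S = -(a * w) * (k ^ 2 * w ^ 2 - δ ^ 2) := by
    linear_combination k ^ 2 * hH - w * hb
  apply mul_left_cancel₀ (pow_ne_zero 2 hk)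
  linear_combination (k ^ 2 * S - a * w * (k ^ 2 * w ^ 2 - δ ^ 2)) * hS +
    (k ^ 2 * w ^ 2 - δ ^ 2) ^ 2 * haw

/-- If the product of a real linear polynomial and a quadratic polynomial with nonzero leading
coefficient vanishes everywhere, then the linear polynomial is zero. -/
lemma linear_eq_zero_of_mul_quadratic_eq_zero {a b c d e : ℝ} (hc : c ≠ 0)
    (h : ∀ v : ℝ, (a * v + b) * (c * v ^ 2 + d * v + e) = 0) : a = 0 ∧ b = 0 := by
  have ha : a = 0 := by
    apply mul_right_cancel₀ hc
    linear_combination (h 2 - 3 * h 1 + 3 * h 0 - h (-1)) / 6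
  subst ha
  refine ⟨rfl, mul_right_cancel₀ hc ?_⟩
  linear_combination (h 1 - 2 * h 0 + h (-1)) / 2

theorem stmt_1 (k δ δ' lam : ℝ) (hδ : δ ≠ 0) (k₁ k₂ : ℝ → ℝ)
    (hK : ∀ v : ℝ, k₁ v * k₂ v = -δ ^ 2 / Real.sqrt (v ^ 2 + δ ^ 2) ^ 4)
    (hH : ∀ v : ℝ, k₁ v + k₂ v =
      -(k * v ^ 2 + δ' * v + δ ^ 2 * (k + lam)) / Real.sqrt (v ^ 2 + δ ^ 2) ^ 3)
    (hrel : ∀ v : ℝ, δ ^ 2 * (k₁ v) ^ 3 + k ^ 4 * k₂ v = 0) :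
    k ≠ 0 ∧ δ' = 0 ∧ k * lam + 1 = 0 := by
  have hw (v : ℝ) : Real.sqrt (v ^ 2 + δ ^ 2) ≠ 0 := by positivity
  have hk : k ≠ 0 := by
    rintro rfl
    have h₁ : k₁ 0 = 0 := by simpa [hδ] using hrel 0
    have hne : -δ ^ 2 / Real.sqrt (0 ^ 2 + δ ^ 2) ^ 4 ≠ 0 :=
      div_ne_zero (neg_ne_zero.2 (pow_ne_zero 2 hδ)) (pow_ne_zero 4 (hw 0))
    exact hne (by rw [← hK 0, h₁, zero_mul])
  have hprod (v : ℝ) : (k * δ' * v + δ ^ 2 * (k * lam + 1)) *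
      (2 * k ^ 2 * v ^ 2 + k * δ' * v + δ ^ 2 * (2 * k ^ 2 + k * lam - 1)) = 0 := by
    have h := sq_mul_eq_of_curvature_relation hδ hk (hw v) (hK v) (hH v) (hrel v)
    rw [Real.sq_sqrt (by positivity)] at h
    linear_combination h
  obtain ⟨h₁, h₂⟩ := linear_eq_zero_of_mul_quadratic_eq_zero (by positivity) hprod
  exact ⟨hk, (mul_eq_zero.1 h₁).resolve_left hk,
    (mul_eq_zero.1 h₂).resolve_left (pow_ne_zero 2 hδ)⟩
end

section
/- Let n be an integer and let k, δ, δ', λ, f be real numbers with δ ≠ 0. Suppose that for every v ∈ ℝ, with w = Real.sqrt (v² + δ²), the identity f·w^(n+1)·(v² + δ²·(λ²+1)) + k·v² + δ'·v + δ²·(k−λ) = 0 holds. Then either (a) f = 0, k = 0, δ' = 0 and λ = 0, or (b) f ≠ 0, n = −1, f = −k, δ' = 0 and λ·(k·λ + 1) = 0. -/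
/-- If `α (4q)ʲ + β qʲ + γ 4ʲ + ε` vanishes for `j = 0, 1, 2, 3` with `α, q ≠ 0`, then `4q` is one
of the other bases `1` and `4`. -/
theorem eq_one_or_eq_quarter_of_expSum_eq_zero {α β γ ε q : ℝ} (hα : α ≠ 0) (hq : q ≠ 0)
    (h : ∀ j < 4, α * (4 * q) ^ j + β * q ^ j + γ * 4 ^ j + ε = 0) : q = 1 ∨ q = 1 / 4 := by
  have h0 := h 0 (by norm_num)
  have h1 := h 1 (by norm_num)
  have h2 := h 2 (by norm_num)
  have h3 := h 3 (by norm_num)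
  have key : α * q * ((q - 1) * (4 * q - 1)) = 0 := by
    linear_combination (h3 - (q + 5) * h2 + (5 * q + 4) * h1 - 4 * q * h0) / 12
  rcases mul_eq_zero.1 ((mul_eq_zero.1 key).resolve_left (mul_ne_zero hα hq)) with h | h
  · left; linarith
  · right; linarith

theorem stmt_2 (n : ℤ) (k δ δ' lam f : ℝ) (hδ : δ ≠ 0)
    (h : ∀ v : ℝ,
      f * Real.sqrt (v ^ 2 + δ ^ 2) ^ (n + 1) * (v ^ 2 + δ ^ 2 * (lam ^ 2 + 1))
        + k * v ^ 2 + δ' * v + δ ^ 2 * (k - lam) = 0) :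
    (f = 0 ∧ k = 0 ∧ δ' = 0 ∧ lam = 0)
    ∨ (f ≠ 0 ∧ n = -1 ∧ f = -k ∧ δ' = 0 ∧ lam * (k * lam + 1) = 0) := by
  have hδ2 : δ ^ 2 ≠ 0 := pow_ne_zero 2 hδ
  have hd : δ' = 0 := by
    have h1 := h 1
    have h2 := h (-1)
    rw [one_pow] at h1
    rw [neg_one_sq] at h2
    linear_combination (h1 - h2) / 2
  subst hd
  by_cases hf : f = 0
  · subst hf
    have h0 := h 0
    have h1 := h 1
    have hkl : k - lam = 0 := (mul_eq_zero.1 (by linear_combination h0)).resolve_left hδ2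
    have hk : k = 0 := by linear_combination h1 - δ ^ 2 * hkl
    exact Or.inl ⟨rfl, hk, rfl, by linarith⟩
  right
  have hw : ∀ w : ℝ, |δ| ≤ w →
      f * w ^ (n + 1) * (w ^ 2 + δ ^ 2 * lam ^ 2) + k * w ^ 2 - δ ^ 2 * lam = 0 := by
    intro w hw
    have hv : Real.sqrt (w ^ 2 - δ ^ 2) ^ 2 = w ^ 2 - δ ^ 2 :=
      Real.sq_sqrt (sub_nonneg.2 (sq_le_sq.2 (hw.trans (le_abs_self w))))
    have hh := h (Real.sqrt (w ^ 2 - δ ^ 2))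
    rw [hv, sub_add_cancel, Real.sqrt_sq ((abs_nonneg δ).trans hw)] at hh
    linear_combination hh
  set A : ℝ := |δ| ^ (n + 1)
  set q : ℝ := 2 ^ (n + 1) with hq_def
  have hA : A ≠ 0 := zpow_ne_zero _ (abs_ne_zero.2 hδ)
  have hq : q ≠ 0 := zpow_ne_zero _ two_ne_zero
  have hα : f * A * δ ^ 2 ≠ 0 := mul_ne_zero (mul_ne_zero hf hA) hδ2
  have hsum : ∀ j : ℕ, (f * A * δ ^ 2) * (4 * q) ^ j + (f * A * δ ^ 2 * lam ^ 2) * q ^ j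
      + (k * δ ^ 2) * 4 ^ j + -(δ ^ 2 * lam) = 0 := by
    intro j
    have hh := hw (|δ| * 2 ^ j) (le_mul_of_one_le_right (abs_nonneg δ) (one_le_pow₀ one_le_two))
    have h4 : ((2 : ℝ) ^ j) ^ 2 = 4 ^ j := by rw [pow_right_comm]; norm_num
    have hpow : ((2 : ℝ) ^ j) ^ (n + 1) = q ^ j := by
      rw [hq_def, ← zpow_natCast, ← zpow_natCast, zpow_comm]
    rw [mul_zpow, hpow, mul_pow, sq_abs, h4] at hh
    rw [mul_pow]
    linear_combination hh
  rcases eq_one_or_eq_quarter_of_expSum_eq_zero hα hq fun j _ => hsum j with h1 | h4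
  · have hn : n + 1 = 0 := (zpow_eq_one_iff_right₀ zero_le_two (by norm_num)).1 h1
    have h0 := h 0
    have h1 := h 1
    simp only [hn, zpow_zero] at h0 h1
    have hfk : f = -k := by linear_combination h1 - h0
    refine ⟨hf, by omega, hfk, rfl, ?_⟩
    refine (mul_eq_zero.1 (?_ : δ ^ 2 * _ = 0)).resolve_left hδ2
    linear_combination -h0 + δ ^ 2 * (lam ^ 2 + 1) * hfk
  · have h0 := hsum 0
    have h1 := hsum 1
    have h2 := hsum 2
    rw [h4] at h0 h1 h2
    have hlam : f * A * δ ^ 2 * lam ^ 2 = 0 := by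
      linear_combination (4 * h0 - 5 * h1 + h2) * (16 / 45)
    have hlam : lam = 0 := pow_eq_zero_iff two_ne_zero |>.1 ((mul_eq_zero.1 hlam).resolve_left hα)
    subst hlam
    refine absurd ?_ hα
    linear_combination (4 * h0 - h1) / 3
end

section
/- Let n be an integer and let k, δ, δ', λ, f be real numbers with δ ≠ 0. Suppose that for every v ∈ ℝ, with w = Real.sqrt (v² + δ²), the identity f·w^(n+3)·(v² + δ²·(λ²+1)) + δ²·λ·((k·λ+2)·v² + δ'·λ·v + δ²·(λ² + k·λ + 2)) = 0 holds. Then either (a) f = 0 and λ = 0, or (b) f ≠ 0, n = −3, δ' = 0, k·λ + 1 = 0 and f = −δ²·λ. -/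
/-- If `g * x ^ m` agrees, for all `x ≥ 1`, with the nondegenerate rational function
`c * (a * x ^ 2 + L) / (x ^ 2 + L)`, then both are constant. -/
theorem eq_zero_and_eq_one_of_mul_zpow_eq {m : ℤ} {a L c g : ℝ} (hL : 0 < L) (hc : c ≠ 0)
    (h : ∀ x : ℝ, 1 ≤ x → g * x ^ m * (x ^ 2 + L) = c * (a * x ^ 2 + L)) :
    m = 0 ∧ a = 1 ∧ g = c := by
  have hP : ∀ x : ℝ, 1 ≤ x →
      (a * x ^ 2 + L) * (16 * a * x ^ 2 + L) * (4 * x ^ 2 + L) ^ 2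
        = (4 * a * x ^ 2 + L) ^ 2 * ((x ^ 2 + L) * (16 * x ^ 2 + L)) := by
    intro x hx
    have h1 := h x hx
    have h2 := h (2 * x) (by linarith)
    have h4 := h (2 * (2 * x)) (by linarith)
    rw [mul_zpow] at h2
    rw [mul_zpow, mul_zpow] at h4
    generalize x ^ m = X at h1 h2 h4
    generalize (2 : ℝ) ^ m = T at h2 h4
    apply mul_left_cancel₀ (pow_ne_zero 2 hc)
    calc c ^ 2 * ((a * x ^ 2 + L) * (16 * a * x ^ 2 + L) * (4 * x ^ 2 + L) ^ 2)
        = (c * (a * x ^ 2 + L)) * (c * (a * (2 * (2 * x)) ^ 2 + L)) * (4 * x ^ 2 + L) ^ 2 := by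
          ring
      _ = (g * (T * X) * ((2 * x) ^ 2 + L)) ^ 2 * ((x ^ 2 + L) * (16 * x ^ 2 + L)) := by
          rw [← h1, ← h4]; ring
      _ = c ^ 2 * ((4 * a * x ^ 2 + L) ^ 2 * ((x ^ 2 + L) * (16 * x ^ 2 + L))) := by
          rw [h2]; ring
  have ha : a = 1 := by
    have h1 := hP 1 le_rfl
    have h2 := hP 2 (by norm_num)
    have h3 := hP 3 (by norm_num)
    have h0 : L ^ 3 * (a - 1) = 0 := by
      linear_combination (3 / 2 * h1 - 3 / 20 * h2 + 1 / 90 * h3) / 9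
    have := (mul_eq_zero.mp h0).resolve_left (by positivity)
    linarith
  subst ha
  have hconst : ∀ x : ℝ, 1 ≤ x → g * x ^ m = c := fun x hx =>
    mul_right_cancel₀ (b := x ^ 2 + L) (by positivity) (by linear_combination h x hx)
  have hg : g = c := by simpa using hconst 1 le_rfl
  subst hg
  refine ⟨?_, rfl, rfl⟩
  have h2 : (2 : ℝ) ^ m = 1 := mul_left_cancel₀ hc (by simpa using hconst 2 (by norm_num))
  exact (zpow_eq_one_iff_right₀ (by norm_num) (by norm_num)).mp h2

theorem stmt_3 (n : ℤ) (k δ δ' lam f : ℝ) (hδ : δ ≠ 0)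
    (h : ∀ v : ℝ,
      f * Real.sqrt (v ^ 2 + δ ^ 2) ^ (n + 3) * (v ^ 2 + δ ^ 2 * (lam ^ 2 + 1))
        + δ ^ 2 * lam * ((k * lam + 2) * v ^ 2 + δ' * lam * v
            + δ ^ 2 * (lam ^ 2 + k * lam + 2)) = 0) :
    (f = 0 ∧ lam = 0)
    ∨ (f ≠ 0 ∧ n = -3 ∧ δ' = 0 ∧ k * lam + 1 = 0 ∧ f = -δ ^ 2 * lam) := by
  have hδ2 : 0 < δ ^ 2 := by positivity
  have hδa : 0 < |δ| := abs_pos.mpr hδ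
  by_cases hl : lam = 0
  · left
    subst hl
    have h0 := h 0
    have hw : |δ| ^ (n + 3) ≠ 0 := (zpow_pos hδa _).ne'
    simpa [Real.sqrt_sq_eq_abs, hδ, hw] using h0
  right
  have hδ' : δ' = 0 := by
    have h1 := h 1
    have h2 := h (-1)
    rw [neg_one_sq] at h2
    rw [one_pow] at h1
    have h3 : δ ^ 2 * lam ^ 2 * δ' = 0 := by linear_combination (h1 - h2) / 2
    exact (mul_eq_zero.mp h3).resolve_left (by positivity)
  subst hδ'
  obtain ⟨hm, ha, hg⟩ := eq_zero_and_eq_one_of_mul_zpow_eq (m := n + 3) (a := k * lam + 2)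
    (L := lam ^ 2) (c := -δ ^ 2 * lam) (g := f * |δ| ^ (n + 3)) (by positivity)
    (mul_ne_zero (neg_ne_zero.mpr hδ2.ne') hl) (by
      intro x hx
      have hv : (|δ| * Real.sqrt (x ^ 2 - 1)) ^ 2 = δ ^ 2 * (x ^ 2 - 1) := by
        rw [mul_pow, sq_abs, Real.sq_sqrt (by nlinarith)]
      have h1 := h (|δ| * Real.sqrt (x ^ 2 - 1))
      have hw : Real.sqrt (δ ^ 2 * (x ^ 2 - 1) + δ ^ 2) = |δ| * x := by
        rw [← Real.sqrt_sq (by positivity : 0 ≤ |δ| * x), mul_pow, sq_abs]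
        congr 1
        ring
      rw [hv, hw, mul_zpow] at h1
      apply mul_left_cancel₀ hδ2.ne'
      linear_combination h1)
  rw [hm, zpow_zero, mul_one] at hg
  refine ⟨?_, by omega, rfl, by linarith, hg⟩
  rw [hg]
  exact mul_ne_zero (neg_ne_zero.mpr hδ2.ne') hl
end

section
/- Let n be an integer and let k, δ, δ', λ, f be real numbers with δ ≠ 0. Suppose that for every v ∈ ℝ, with w = Real.sqrt (v² + δ²), the identity f·w^(n+3) + k·v² + δ'·v + δ²·(k+λ) = 0 holds. Then either (a) f = 0, k = 0, δ' = 0 and λ = 0, or (b) f ≠ 0, n = −3, k = 0, δ' = 0 and f = −δ²·λ, or (c) f ≠ 0, n = −1, f = −k, δ' = 0 and λ = 0. -/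
/-- If `A t ^ m + B t ^ 2 + C` vanishes at `t = 1, 2, 4` with `A ≠ 0`, then `m` is `0` or `2`. -/
theorem zpow_exponent_eq_zero_or_two {m : ℤ} {A B C : ℝ} (hA : A ≠ 0)
    (h : ∀ t : ℝ, 1 ≤ t → A * t ^ m + B * t ^ 2 + C = 0) : m = 0 ∨ m = 2 := by
  have h1 := h 1 le_rfl
  have h2 := h 2 (by norm_num)
  have h4 := h (2 * 2) (by norm_num)
  rw [one_zpow] at h1
  rw [mul_zpow] at h4
  have inj : Function.Injective fun j : ℤ => (2 : ℝ) ^ j :=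
    zpow_right_injective₀ (by norm_num) (by norm_num)
  have hx : A * (((2 : ℝ) ^ m - 1) * ((2 : ℝ) ^ m - 4)) = 0 := by
    linear_combination h4 - 5 * h2 + 4 * h1
  rcases mul_eq_zero.mp ((mul_eq_zero.mp hx).resolve_left hA) with hx | hx
  · exact Or.inl (inj (by simpa using sub_eq_zero.mp hx))
  · refine Or.inr (inj ?_)
    change (2 : ℝ) ^ m = 2 ^ (2 : ℤ)
    rw [sub_eq_zero.mp hx]
    norm_num

theorem stmt_4 (n : ℤ) (k δ δ' lam f : ℝ) (hδ : δ ≠ 0)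
    (h : ∀ v : ℝ,
      f * Real.sqrt (v ^ 2 + δ ^ 2) ^ (n + 3)
        + k * v ^ 2 + δ' * v + δ ^ 2 * (k + lam) = 0) :
    (f = 0 ∧ k = 0 ∧ δ' = 0 ∧ lam = 0)
    ∨ (f ≠ 0 ∧ n = -3 ∧ k = 0 ∧ δ' = 0 ∧ f = -δ ^ 2 * lam)
    ∨ (f ≠ 0 ∧ n = -1 ∧ f = -k ∧ δ' = 0 ∧ lam = 0) := by
  have hδ' : δ' = 0 := by
    have h1 := h 1
    have h2 := h (-1)
    rw [neg_one_sq] at h2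
    rw [one_pow] at h1
    linear_combination (h1 - h2) / 2
  have hδ2 : δ ^ 2 ≠ 0 := pow_ne_zero 2 hδ
  have key : ∀ t : ℝ, 1 ≤ t →
      f * |δ| ^ (n + 3) * t ^ (n + 3) + k * δ ^ 2 * t ^ 2 + δ ^ 2 * lam = 0 := by
    intro t ht
    have hv : (δ * Real.sqrt (t ^ 2 - 1)) ^ 2 = δ ^ 2 * (t ^ 2 - 1) := by
      rw [mul_pow, Real.sq_sqrt (by nlinarith)]
    have hw : Real.sqrt (δ ^ 2 * (t ^ 2 - 1) + δ ^ 2) = |δ| * t := by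
      rw [show δ ^ 2 * (t ^ 2 - 1) + δ ^ 2 = (δ * t) ^ 2 by ring, Real.sqrt_sq_eq_abs, abs_mul,
        abs_of_nonneg (zero_le_one.trans ht)]
    have hh := h (δ * Real.sqrt (t ^ 2 - 1))
    rw [hv, hw, hδ', mul_zpow] at hh
    linear_combination hh
  have h1 := key 1 le_rfl
  have h2 := key 2 (by norm_num)
  rw [one_zpow] at h1
  by_cases hf : f = 0
  · subst hf
    have hk : δ ^ 2 * k = 0 := by linear_combination (h2 - h1) / 3
    have hl : δ ^ 2 * lam = 0 := by linear_combination (4 * h1 - h2) / 3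
    exact Or.inl ⟨rfl, (mul_eq_zero.mp hk).resolve_left hδ2, hδ',
      (mul_eq_zero.mp hl).resolve_left hδ2⟩
  · have hA : f * |δ| ^ (n + 3) ≠ 0 := mul_ne_zero hf (zpow_ne_zero _ (abs_ne_zero.mpr hδ))
    rcases zpow_exponent_eq_zero_or_two hA key with hm | hm
    · rw [hm, zpow_zero] at h1 h2
      rw [zpow_zero] at h2
      have hk : δ ^ 2 * k = 0 := by linear_combination (h2 - h1) / 3
      exact Or.inr (Or.inl ⟨hf, by lia, (mul_eq_zero.mp hk).resolve_left hδ2, hδ',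
        by linear_combination h1 - hk⟩)
    · have hs : |δ| ^ (2 : ℤ) = δ ^ 2 := by rw [zpow_ofNat, sq_abs]
      rw [hm, hs] at h1 h2
      rw [zpow_ofNat] at h2
      have hk : δ ^ 2 * (f + k) = 0 := by linear_combination (h2 - h1) / 3
      have hl : δ ^ 2 * lam = 0 := by linear_combination h1 - hk
      exact Or.inr (Or.inr ⟨hf, by lia,
        eq_neg_of_add_eq_zero_left ((mul_eq_zero.mp hk).resolve_left hδ2), hδ',
        (mul_eq_zero.mp hl).resolve_left hδ2⟩)
end

section
/- Let n be an integer and let k, δ, δ', λ, f be real numbers with δ ≠ 0. Suppose that for every v ∈ ℝ, with w = Real.sqrt (v² + δ²), the identity f·w^(n+1)·((4δ² + δ'²)·v⁴ + 4δ²·δ'·λ·v³ + 2δ²·(2δ²·(λ²+1) − δ'²)·v² − 4δ⁴·δ'·λ·v + δ⁴·δ'²) + 4δ²·v·(k·v³ + δ²·(k−λ)·v + δ²·δ') = 0 holds. Then either (a) f = 0, k = 0, δ' = 0 and λ = 0, or (b) f ≠ 0, n = −1, f = −k, δ' = 0 and λ·(k·λ + 1) = 0. -/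
open Polynomial in
/-- A real polynomial vanishing on `(1, ∞)` is zero. -/
theorem Polynomial.eq_zero_of_eval_eq_zero_of_one_lt {p : ℝ[X]}
    (hp : ∀ y : ℝ, 1 < y → p.eval y = 0) : p = 0 :=
  Polynomial.eq_zero_of_infinite_isRoot p ((Set.Ioi_infinite (1 : ℝ)).mono fun y hy => hp y hy)

open Polynomial in
theorem zpow_mul_quadratic_rigidity {m : ℤ} {g k l : ℝ} (hg : g ≠ 0)
    (h : ∀ y : ℝ, 1 < y → g * y ^ m * (y ^ 2 + l ^ 2) + k * y ^ 2 - l = 0) :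
    m = 0 ∧ g = -k ∧ g * l ^ 2 = l := by
  obtain ⟨a, rfl | rfl⟩ := m.eq_nat_or_neg
  · have hp : C g * X ^ (a + 2) + C (g * l ^ 2) * X ^ a + C k * X ^ 2 - C l = 0 := by
      refine eq_zero_of_eval_eq_zero_of_one_lt fun y hy => ?_
      have := h y hy
      simp only [zpow_natCast] at this
      simp only [eval_add, eval_sub, eval_mul, eval_C, eval_X, eval_pow]
      linear_combination this
    have hc (i : ℕ) := congrArg (fun q : ℝ[X] => q.coeff i) hp
    simp only [coeff_add, coeff_sub, coeff_C_mul, coeff_X_pow, coeff_C, coeff_zero] at hc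
    rcases Nat.eq_zero_or_pos a with rfl | ha
    · have h₀ := hc 0
      have h₂ := hc 2
      norm_num at h₀ h₂
      exact ⟨rfl, by linarith, by linarith⟩
    · have := hc (a + 2)
      simp [ha.ne', hg] at this
  · rcases Nat.eq_zero_or_pos a with rfl | ha
    · have h₁ := h 2 (by norm_num)
      have h₂ := h 3 (by norm_num)
      norm_num at h₁ h₂
      exact ⟨rfl, by linarith, by linarith⟩
    · have hp : C g * X ^ 2 + C (g * l ^ 2) + C k * X ^ (a + 2) - C l * X ^ a = 0 := by
        refine eq_zero_of_eval_eq_zero_of_one_lt fun y hy => ?_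
        have hy₀ : y ^ a ≠ 0 := pow_ne_zero _ (by linarith)
        have := h y hy
        simp only [zpow_neg, zpow_natCast] at this
        field_simp at this
        simp only [eval_add, eval_sub, eval_mul, eval_C, eval_X, eval_pow]
        linear_combination this
      have hc (i : ℕ) := congrArg (fun q : ℝ[X] => q.coeff i) hp
      simp only [coeff_add, coeff_sub, coeff_C_mul, coeff_X_pow, coeff_C, coeff_zero] at hc
      have hk : k = 0 := by simpa [ha.ne'] using hc (a + 2)
      have hl : l = 0 := by simpa [ha.ne, hg] using hc 0
      exact absurd (by simpa [hk, hl] using hc 2) hg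


theorem stmt_5 (n : ℤ) (k δ δ' lam f : ℝ) (hδ : δ ≠ 0)
    (h : ∀ v : ℝ,
      f * Real.sqrt (v ^ 2 + δ ^ 2) ^ (n + 1)
          * ((4 * δ ^ 2 + δ' ^ 2) * v ^ 4 + 4 * δ ^ 2 * δ' * lam * v ^ 3
            + 2 * δ ^ 2 * (2 * δ ^ 2 * (lam ^ 2 + 1) - δ' ^ 2) * v ^ 2
            - 4 * δ ^ 4 * δ' * lam * v + δ ^ 4 * δ' ^ 2)
        + 4 * δ ^ 2 * v * (k * v ^ 3 + δ ^ 2 * (k - lam) * v + δ ^ 2 * δ') = 0) :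
    (f = 0 ∧ k = 0 ∧ δ' = 0 ∧ lam = 0)
    ∨ (f ≠ 0 ∧ n = -1 ∧ f = -k ∧ δ' = 0 ∧ lam * (k * lam + 1) = 0) := by
  by_cases hf : f = 0
  · have h₁ := h 1
    have h₂ := h (-1)
    have h₃ := h 2
    simp only [hf, zero_mul, zero_add, mul_eq_zero, pow_eq_zero_iff, ne_eq, hδ,
      OfNat.ofNat_ne_zero, not_false_eq_true, one_ne_zero, neg_eq_zero, false_or] at h₁ h₂ h₃
    have hδ2 : δ ^ 2 ≠ 0 := pow_ne_zero 2 hδ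
    have hd : δ' = 0 := (mul_eq_zero.mp (by linarith : δ ^ 2 * δ' = 0)).resolve_left hδ2
    subst hd
    have hk : k = 0 := by linarith
    subst hk
    have hl : lam = 0 := (mul_eq_zero.mp (by linarith : δ ^ 2 * lam = 0)).resolve_left hδ2
    exact Or.inl ⟨hf, rfl, rfl, hl⟩
  · have hd : δ' = 0 := by
      have hw : Real.sqrt (0 ^ 2 + δ ^ 2) ^ (n + 1) ≠ 0 := zpow_ne_zero _ (by positivity)
      have h₀ := h 0
      simp only [mul_zero, zero_mul, add_zero] at h₀
      rcases mul_eq_zero.mp h₀ with h₀ | h₀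
      · exact absurd h₀ (mul_ne_zero hf hw)
      · simpa [hδ] using h₀
    subst hd
    have hδ₀ : |δ| ≠ 0 := abs_ne_zero.mpr hδ
    obtain ⟨hn, hk, hl⟩ := zpow_mul_quadratic_rigidity (m := n + 1) (g := f * |δ| ^ (n + 1))
      (k := k) (l := lam) (mul_ne_zero hf (zpow_ne_zero _ hδ₀)) fun y hy => by
        have hy₁ : 0 < y ^ 2 - 1 := by nlinarith
        have hv := h (δ * Real.sqrt (y ^ 2 - 1))
        have hs := Real.sq_sqrt hy₁.le
        have hw : Real.sqrt ((δ * Real.sqrt (y ^ 2 - 1)) ^ 2 + δ ^ 2) = |δ| * y := by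
          rw [mul_pow, hs, show δ ^ 2 * (y ^ 2 - 1) + δ ^ 2 = (δ * y) ^ 2 by ring,
            Real.sqrt_sq_eq_abs, abs_mul, abs_of_pos (by linarith : 0 < y)]
        rw [hw, mul_zpow] at hv
        generalize Real.sqrt (y ^ 2 - 1) = r at hv hs
        have hr : y ^ 2 = r ^ 2 + 1 := by linarith
        have hc : 4 * δ ^ 6 * r ^ 2 ≠ 0 :=
          mul_ne_zero (mul_ne_zero four_ne_zero (pow_ne_zero _ hδ)) (hs ▸ hy₁.ne')
        refine (mul_eq_zero.mp ?_).resolve_left hc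
        rw [hr]
        linear_combination hv
    rw [hn, zpow_zero, mul_one] at hk hl
    exact Or.inr ⟨hf, by linarith, hk, rfl, by rw [hk] at hl; linear_combination -hl⟩
end

section
/- Let k, δ, δ', λ be real numbers with δ ≠ 0. Then there is no real number f such that for every v ∈ ℝ, with w = Real.sqrt (v² + δ²), the identity f²·w⁴ + f·(k·v² + δ'·v + δ²·(k+λ))·w − δ² = 0 holds. -/
theorem stmt_6 (k δ δ' lam : ℝ) (hδ : δ ≠ 0) :
    ¬ ∃ f : ℝ, ∀ v : ℝ,
      f ^ 2 * Real.sqrt (v ^ 2 + δ ^ 2) ^ 4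
        + f * (k * v ^ 2 + δ' * v + δ ^ 2 * (k + lam)) * Real.sqrt (v ^ 2 + δ ^ 2)
        - δ ^ 2 = 0 := by
  rintro ⟨f, hf⟩
  -- Isolating the odd power of the square root and squaring gives a polynomial identity in `v`.
  have key (v : ℝ) : (f ^ 2 * (v ^ 2 + δ ^ 2) ^ 2 - δ ^ 2) ^ 2
      = f ^ 2 * (k * v ^ 2 + δ' * v + δ ^ 2 * (k + lam)) ^ 2 * (v ^ 2 + δ ^ 2) := by
    have h := hf v
    have hw : Real.sqrt (v ^ 2 + δ ^ 2) ^ 2 = v ^ 2 + δ ^ 2 := Real.sq_sqrt (by positivity)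
    generalize Real.sqrt (v ^ 2 + δ ^ 2) = w at h hw
    rw [← hw]
    linear_combination (f ^ 2 * w ^ 4 - δ ^ 2
      - f * (k * v ^ 2 + δ' * v + δ ^ 2 * (k + lam)) * w) * h
  -- The eighth central difference extracts the coefficient of `v ^ 8`.
  have h4 : f ^ 4 = 0 := by
    linear_combination (70 * key 0 - 56 * (key 1 + key (-1)) + 28 * (key 2 + key (-2))
      - 8 * (key 3 + key (-3)) + (key 4 + key (-4))) / 40320
  have hf0 : f = 0 := eq_zero_of_pow_eq_zero h4
  have h0 := hf 0
  simp [hf0, hδ] at h0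
end

section
/- Let n be an odd integer with n ≥ 1 and let k, δ, δ', λ, f be real numbers with δ ≠ 0 and f ≠ 0. Then it is not the case that for every v ∈ ℝ, with w = Real.sqrt (v² + δ²), the identity f²·w^(2n+4) + f·(k·v² + δ'·v + δ²·(k+λ))·w^(n+1) − δ² = 0 holds. -/
open Polynomial in
theorem not_forall_quadratic_relation_pow (m : ℕ) (a b c d r : ℝ) (hd : d ≠ 0) :
    ¬ ∀ s : ℝ, r ≤ s → a * s ^ (2 * m + 3) + (b * s + c) * s ^ (m + 1) - d = 0 := by
  intro h
  let p : ℝ[X] := C a * X ^ (2 * m + 3) + (C b * X + C c) * X ^ (m + 1) - C d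
  have hp : p = 0 := by
    refine eq_zero_of_infinite_isRoot p ((Set.Ici_infinite r).mono fun s hs => ?_)
    simpa [p] using h s hs
  have h0 : p.eval 0 = 0 := by simp [hp]
  exact hd (by simpa [p] using h0)

theorem stmt_7 (n : ℤ) (hodd : Odd n) (hn : 1 ≤ n) (k δ δ' lam f : ℝ)
    (hδ : δ ≠ 0) (hf : f ≠ 0) :
    ¬ ∀ v : ℝ,
      f ^ 2 * Real.sqrt (v ^ 2 + δ ^ 2) ^ (2 * n + 4)
        + f * (k * v ^ 2 + δ' * v + δ ^ 2 * (k + lam))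
            * Real.sqrt (v ^ 2 + δ ^ 2) ^ (n + 1)
        - δ ^ 2 = 0 := by
  intro h
  obtain ⟨j, rfl⟩ := hodd
  obtain ⟨m, rfl⟩ := Int.eq_ofNat_of_zero_le (show 0 ≤ j by omega)
  refine not_forall_quadratic_relation_pow m (f ^ 2) (f * k) (f * (δ ^ 2 * lam)) (δ ^ 2) (δ ^ 2)
    (pow_ne_zero 2 hδ) fun s hs => ?_
  have hs0 : 0 ≤ s := (sq_nonneg δ).trans hs
  have hv : Real.sqrt (s - δ ^ 2) ^ 2 = s - δ ^ 2 := Real.sq_sqrt (sub_nonneg.2 hs)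
  have e1 : Real.sqrt s ^ (2 * (2 * (m : ℤ) + 1) + 4) = s ^ (2 * m + 3) := by
    rw [show 2 * (2 * (m : ℤ) + 1) + 4 = ((2 * (2 * m + 3) : ℕ) : ℤ) by push_cast; ring,
      zpow_natCast, pow_mul, Real.sq_sqrt hs0]
  have e2 : Real.sqrt s ^ (2 * (m : ℤ) + 1 + 1) = s ^ (m + 1) := by
    rw [show 2 * (m : ℤ) + 1 + 1 = ((2 * (m + 1) : ℕ) : ℤ) by push_cast; ring,
      zpow_natCast, pow_mul, Real.sq_sqrt hs0]
  have h1 := h (Real.sqrt (s - δ ^ 2))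
  have h2 := h (-Real.sqrt (s - δ ^ 2))
  simp only [neg_sq, hv, sub_add_cancel, e1, e2] at h1 h2
  linear_combination (h1 + h2) / 2
end

section
/- Let k, δ, δ', λ, f be real numbers with δ ≠ 0. Suppose that for every v ∈ ℝ the identity f²·(v² + δ²) + f·(k·v² + δ'·v + δ²·(k+λ)) − δ² = 0 holds. Then f = −k, δ' = 0 and k·λ + 1 = 0. -/
theorem stmt_8 (k δ δ' lam f : ℝ) (hδ : δ ≠ 0)
    (h : ∀ v : ℝ,
      f ^ 2 * (v ^ 2 + δ ^ 2)
        + f * (k * v ^ 2 + δ' * v + δ ^ 2 * (k + lam)) - δ ^ 2 = 0) :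
    f = -k ∧ δ' = 0 ∧ k * lam + 1 = 0 := by
  have h0 := h 0
  have h1 := h 1
  have h2 := h (-1)
  have hconst : f * (f + k + lam) = 1 :=
    mul_left_cancel₀ (pow_ne_zero 2 hδ) (by linear_combination h0)
  have hf : f ≠ 0 := left_ne_zero_of_mul_eq_one hconst
  have hk : f = -k :=
    mul_left_cancel₀ hf (by linear_combination (h1 + h2) / 2 - h0)
  have hδ' : δ' = 0 :=
    mul_left_cancel₀ hf (by linear_combination (h1 - h2) / 2)
  refine ⟨hk, hδ', ?_⟩
  rw [hk] at hconst
  linear_combination -hconst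
end

section
/- Let k, δ, δ', λ, f be real numbers with δ ≠ 0 and f ≠ 0. Suppose that for every v ∈ ℝ, with w = Real.sqrt (v² + δ²), the identity f² + f·(k·v² + δ'·v + δ²·(k+λ))·w⁻¹ − δ² = 0 holds. Then k = 0, δ' = 0, λ = 0 and (f = δ or f = −δ). -/
/-- Clearing the square root along a rational point `(t, m)` of the hyperbola `m ^ 2 = t ^ 2 + 1`. -/
lemma discriminant_eq_at_rational_point {k δ δ' lam f : ℝ} (hδ : δ ≠ 0)
    (h : ∀ v : ℝ,
      f ^ 2
        + f * (k * v ^ 2 + δ' * v + δ ^ 2 * (k + lam))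
            * (Real.sqrt (v ^ 2 + δ ^ 2))⁻¹
        - δ ^ 2 = 0) {t m : ℝ} (hm : 0 < m) (htm : m ^ 2 = t ^ 2 + 1) :
    f * (k * (|δ| * t) ^ 2 + δ' * (|δ| * t) + |δ| ^ 2 * (k + lam))
      = (δ ^ 2 - f ^ 2) * (|δ| * m) := by
  have ha : 0 < |δ| := abs_pos.mpr hδ
  have hw : Real.sqrt ((|δ| * t) ^ 2 + δ ^ 2) = |δ| * m := by
    rw [← sq_abs δ, show (|δ| * t) ^ 2 + |δ| ^ 2 = (|δ| * m) ^ 2 by rw [mul_pow _ m, htm]; ring]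
    exact Real.sqrt_sq (by positivity)
  have h₁ := h (|δ| * t)
  rw [hw] at h₁
  have hne : |δ| * m ≠ 0 := by positivity
  rw [sq_abs, ← mul_inv_eq_iff_eq_mul₀ hne]
  linarith

theorem stmt_9 (k δ δ' lam f : ℝ) (hδ : δ ≠ 0) (hf : f ≠ 0)
    (h : ∀ v : ℝ,
      f ^ 2
        + f * (k * v ^ 2 + δ' * v + δ ^ 2 * (k + lam))
            * (Real.sqrt (v ^ 2 + δ ^ 2))⁻¹
        - δ ^ 2 = 0) :
    k = 0 ∧ δ' = 0 ∧ lam = 0 ∧ (f = δ ∨ f = -δ) := by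
  have ha : |δ| ≠ 0 := abs_ne_zero.mpr hδ
  have h₀ := discriminant_eq_at_rational_point hδ h (t := 0) (m := 1) (by norm_num) (by norm_num)
  have h₁ := discriminant_eq_at_rational_point hδ h (t := 3 / 4) (m := 5 / 4)
    (by norm_num) (by norm_num)
  have h₂ := discriminant_eq_at_rational_point hδ h (t := -(3 / 4)) (m := 5 / 4)
    (by norm_num) (by norm_num)
  have h₃ := discriminant_eq_at_rational_point hδ h (t := 4 / 3) (m := 5 / 3)
    (by norm_num) (by norm_num)
  have hδ' : f * |δ| * δ' = 0 := by linarith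
  have hk : f * |δ| ^ 2 * k = 0 := by linarith
  have hlam : f * |δ| ^ 2 * lam = 0 := by linarith
  have hc : (δ ^ 2 - f ^ 2) * |δ| = 0 := by linarith
  simp only [mul_eq_zero, pow_eq_zero_iff two_ne_zero, hf, ha, false_or, or_false]
    at hδ' hk hlam hc
  exact ⟨hk, hδ', hlam, sq_eq_sq_iff_eq_or_eq_neg.mp (by linarith)⟩
end

section
/- Let k, δ, δ', λ, f be real numbers with δ ≠ 0 and f ≠ 0. Suppose that for every v ∈ ℝ, with w = Real.sqrt (v² + δ²), the identity f²·w⁻² + f·(k·v² + δ'·v + δ²·(k+λ))·w⁻² − δ² = 0 holds. Then k ≠ 0, f·k = δ², δ' = 0 and k·λ + 1 = 0. -/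
theorem stmt_10 (k δ δ' lam f : ℝ) (hδ : δ ≠ 0) (hf : f ≠ 0)
    (h : ∀ v : ℝ,
      f ^ 2 * Real.sqrt (v ^ 2 + δ ^ 2) ^ (-2 : ℤ)
        + f * (k * v ^ 2 + δ' * v + δ ^ 2 * (k + lam))
            * Real.sqrt (v ^ 2 + δ ^ 2) ^ (-2 : ℤ)
        - δ ^ 2 = 0) :
    k ≠ 0 ∧ f * k = δ ^ 2 ∧ δ' = 0 ∧ k * lam + 1 = 0 := by
  have hpoly (v : ℝ) :
      f ^ 2 + f * (k * v ^ 2 + δ' * v + δ ^ 2 * (k + lam)) = δ ^ 2 * (v ^ 2 + δ ^ 2) := by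
    have hpos : 0 < v ^ 2 + δ ^ 2 := by positivity
    have hv := h v
    rw [zpow_neg, zpow_ofNat, Real.sq_sqrt hpos.le] at hv
    field_simp at hv
    linarith
  have h0 := hpoly 0
  have h1 := hpoly 1
  have h2 := hpoly (-1)
  have hδ2 : δ ^ 2 ≠ 0 := pow_ne_zero 2 hδ
  have hfk : f * k = δ ^ 2 := by linarith
  have hδ' : δ' = 0 := (mul_eq_zero.mp (by linarith : f * δ' = 0)).resolve_left hf
  have hflam : f + δ ^ 2 * lam = 0 :=
    (mul_eq_zero.mp (by linear_combination h0 - δ ^ 2 * hfk :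
      f * (f + δ ^ 2 * lam) = 0)).resolve_left hf
  refine ⟨right_ne_zero_of_mul (hfk ▸ hδ2), hfk, hδ', ?_⟩
  exact (mul_eq_zero.mp (by linear_combination k * hflam - hfk :
    δ ^ 2 * (k * lam + 1) = 0)).resolve_left hδ2
end

section
/- Let n be an odd integer with n ≤ −5 and let k, δ, δ', λ, f be real numbers with δ ≠ 0 and f ≠ 0. Then it is not the case that for every v ∈ ℝ, with w = Real.sqrt (v² + δ²), the identity f²·w^(2n+4) + f·(k·v² + δ'·v + δ²·(k+λ))·w^(n+1) − δ² = 0 holds. -/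
theorem stmt_11 (n : ℤ) (hodd : Odd n) (hn : n ≤ -5) (k δ δ' lam f : ℝ)
    (hδ : δ ≠ 0) (hf : f ≠ 0) :
    ¬ ∀ v : ℝ,
      f ^ 2 * Real.sqrt (v ^ 2 + δ ^ 2) ^ (2 * n + 4)
        + f * (k * v ^ 2 + δ' * v + δ ^ 2 * (k + lam))
            * Real.sqrt (v ^ 2 + δ ^ 2) ^ (n + 1)
        - δ ^ 2 = 0 := by
  intro h
  have hδ2 : 0 < δ ^ 2 := by positivity
  set A := |k| + |δ'| + δ ^ 2 * |k + lam| with hA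
  set C := f ^ 2 + |f| * A
  have hC0 : 0 ≤ C := by positivity
  set v := 1 + C / δ ^ 2 with hv
  have hv1 : 1 ≤ v := le_add_of_nonneg_right (by positivity)
  have hvC : C < v * δ ^ 2 := by
    have : v * δ ^ 2 = δ ^ 2 + C := by rw [hv]; field_simp
    linarith
  have hid := h v
  set w := Real.sqrt (v ^ 2 + δ ^ 2)
  have hvw : v ≤ w := Real.le_sqrt_of_sq_le (by linarith)
  have hw1 : 1 ≤ w := hv1.trans hvw
  have hw0 : 0 < w := by linarith
  have ha : w ^ (2 * n + 4) * w ^ 2 ≤ 1 := by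
    rw [← zpow_natCast, ← zpow_add₀ hw0.ne']
    exact zpow_le_one_of_nonpos₀ hw1 (by push_cast; omega)
  have hb : w ^ (n + 1) * w ^ 4 ≤ 1 := by
    rw [← zpow_natCast, ← zpow_add₀ hw0.ne']
    exact zpow_le_one_of_nonpos₀ hw1 (by push_cast; omega)
  have hq : |k * v ^ 2 + δ' * v + δ ^ 2 * (k + lam)| ≤ A * w ^ 2 := by
    have hv2 : v ^ 2 ≤ w ^ 2 := by gcongr
    calc |k * v ^ 2 + δ' * v + δ ^ 2 * (k + lam)|
        ≤ |k * v ^ 2| + |δ' * v| + |δ ^ 2 * (k + lam)| := abs_add_three _ _ _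
      _ = |k| * v ^ 2 + |δ'| * v + δ ^ 2 * |k + lam| * 1 := by
          rw [abs_mul, abs_mul, abs_mul, abs_of_pos hδ2, abs_of_nonneg (sq_nonneg v),
            abs_of_nonneg (zero_le_one.trans hv1), mul_one]
      _ ≤ |k| * w ^ 2 + |δ'| * w ^ 2 + δ ^ 2 * |k + lam| * w ^ 2 := by
          gcongr
          · nlinarith
          · nlinarith
      _ = A * w ^ 2 := by rw [hA]; ring
  have hfq : f * (k * v ^ 2 + δ' * v + δ ^ 2 * (k + lam)) ≤ |f| * (A * w ^ 2) :=
    (le_abs_self _).trans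
      ((abs_mul _ _).trans_le (mul_le_mul_of_nonneg_left hq (abs_nonneg f)))
  have hmid : f * (k * v ^ 2 + δ' * v + δ ^ 2 * (k + lam)) * w ^ (n + 1) * w ^ 2
      ≤ |f| * A := by
    calc f * (k * v ^ 2 + δ' * v + δ ^ 2 * (k + lam)) * w ^ (n + 1) * w ^ 2
        ≤ |f| * (A * w ^ 2) * w ^ (n + 1) * w ^ 2 := by
          gcongr
      _ = |f| * A * (w ^ (n + 1) * w ^ 4) := by ring
      _ ≤ |f| * A := mul_le_of_le_one_right (by positivity) hb
  have hfirst : f ^ 2 * (w ^ (2 * n + 4) * w ^ 2) ≤ f ^ 2 :=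
    mul_le_of_le_one_right (by positivity) ha
  have hlow : v * δ ^ 2 ≤ w ^ 2 * δ ^ 2 := by
    gcongr
    nlinarith
  have hmul := congrArg (· * w ^ 2) hid
  simp only [zero_mul] at hmul
  linarith
end

section
/- Let n be an even integer with n ≥ 2 or n ≤ −4, and let k, δ, δ', λ, f be real numbers with δ ≠ 0 and f ≠ 0. Then it is not the case that for every v ∈ ℝ, with w = Real.sqrt (v² + δ²), the identity f²·w^(2n+4) + f·(k·v² + δ'·v + δ²·(k+λ))·w^(n+1) − δ² = 0 holds. -/
open Filter Topology

/-- Averaging the discriminant identity over `v` and `-v` removes the term linear in `v`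
and leaves an identity in `w = √(v² + δ²)` alone. -/
lemma averaged_discriminant_identity {n : ℤ} {k δ δ' lam f : ℝ}
    (h : ∀ v : ℝ,
      f ^ 2 * Real.sqrt (v ^ 2 + δ ^ 2) ^ (2 * n + 4)
        + f * (k * v ^ 2 + δ' * v + δ ^ 2 * (k + lam))
            * Real.sqrt (v ^ 2 + δ ^ 2) ^ (n + 1)
        - δ ^ 2 = 0)
    {w : ℝ} (hw : 0 < w) (hδw : |δ| ≤ w) :
    f ^ 2 * w ^ (2 * n + 4) + f * k * w ^ (n + 3) + f * δ ^ 2 * lam * w ^ (n + 1) = δ ^ 2 := by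
  have hsq : δ ^ 2 ≤ w ^ 2 := sq_le_sq.mpr (hδw.trans (le_abs_self w))
  have hv : Real.sqrt (w ^ 2 - δ ^ 2) ^ 2 = w ^ 2 - δ ^ 2 := Real.sq_sqrt (by linarith)
  have h₁ := h (Real.sqrt (w ^ 2 - δ ^ 2))
  have h₂ := h (-Real.sqrt (w ^ 2 - δ ^ 2))
  rw [neg_sq] at h₂
  rw [hv, sub_add_cancel, Real.sqrt_sq hw.le] at h₁ h₂
  have hpow : w ^ (n + 3) = w ^ (n + 1) * w ^ 2 := by
    rw [← zpow_natCast w 2, ← zpow_add₀ hw.ne']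
    congr 1
    push_cast
    ring
  rw [hpow]
  linear_combination (h₁ + h₂) / 2

theorem stmt_12 (n : ℤ) (heven : Even n) (hn : 2 ≤ n ∨ n ≤ -4) (k δ δ' lam f : ℝ)
    (hδ : δ ≠ 0) (hf : f ≠ 0) :
    ¬ ∀ v : ℝ,
      f ^ 2 * Real.sqrt (v ^ 2 + δ ^ 2) ^ (2 * n + 4)
        + f * (k * v ^ 2 + δ' * v + δ ^ 2 * (k + lam))
            * Real.sqrt (v ^ 2 + δ ^ 2) ^ (n + 1)
        - δ ^ 2 = 0 := by
  intro h
  have key : ∀ᶠ w : ℝ in atTop, 0 < w ∧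
      f ^ 2 * w ^ (2 * n + 4) + f * k * w ^ (n + 3) + f * δ ^ 2 * lam * w ^ (n + 1) = δ ^ 2 := by
    filter_upwards [eventually_gt_atTop 0, eventually_ge_atTop |δ|] with w hw hδw
    exact ⟨hw, averaged_discriminant_identity h hw hδw⟩
  have lim {m : ℤ} (c : ℝ) (hm : m < 0) : Tendsto (fun w : ℝ => c * w ^ m) atTop (𝓝 0) := by
    simpa using (tendsto_zpow_atTop_zero hm).const_mul c
  rcases hn with hn | hn
  · have hlim := ((lim (m := -(2 * n + 4)) (δ ^ 2) (by lia)).sub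
      (lim (m := -(n + 1)) (f * k) (by lia))).sub
      (lim (m := -(n + 3)) (f * δ ^ 2 * lam) (by lia))
    have heq : ∀ᶠ w : ℝ in atTop, δ ^ 2 * w ^ (-(2 * n + 4)) - f * k * w ^ (-(n + 1))
        - f * δ ^ 2 * lam * w ^ (-(n + 3)) = f ^ 2 := by
      filter_upwards [key] with w ⟨hw, hkey⟩
      have h₀ : w ^ (2 * n + 4) * w ^ (-(2 * n + 4)) = 1 := by
        rw [← zpow_add₀ hw.ne', add_neg_cancel, zpow_zero]
      have h₁ : w ^ (-(n + 1)) = w ^ (n + 3) * w ^ (-(2 * n + 4)) := by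
        rw [← zpow_add₀ hw.ne']
        congr 1
        ring
      have h₂ : w ^ (-(n + 3)) = w ^ (n + 1) * w ^ (-(2 * n + 4)) := by
        rw [← zpow_add₀ hw.ne']
        congr 1
        ring
      rw [h₁, h₂]
      linear_combination f ^ 2 * h₀ - w ^ (-(2 * n + 4)) * hkey
    have := tendsto_nhds_unique (tendsto_const_nhds.congr' (heq.mono fun _ e => e.symm)) hlim
    exact pow_ne_zero 2 hf (by simpa using this)
  · have hlim := ((lim (m := 2 * n + 4) (f ^ 2) (by lia)).add
      (lim (m := n + 3) (f * k) (by lia))).add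
      (lim (m := n + 1) (f * δ ^ 2 * lam) (by lia))
    have := tendsto_nhds_unique (tendsto_const_nhds.congr' (key.mono fun _ e => e.2.symm)) hlim
    exact pow_ne_zero 2 hδ (by simpa using this)
end

section
/- Let v, k, δ, λ be real numbers with δ ≠ 0, k ≠ 0 and k·λ + 1 = 0, and set w = Real.sqrt (v² + δ²). Define g₁₁ = v² + δ²·(λ²+1), g₁₂ = δ·λ, g₂₂ = 1, h₁₁ = −(k·v² + δ²·(k−λ))/w, h₁₂ = δ/w, h₂₂ = 0. Then for a real number κ, the equation (h₁₁ − κ·g₁₁)·(h₂₂ − κ·g₂₂) − (h₁₂ − κ·g₁₂)² = 0 holds if and only if κ = −k/w or κ = δ²/(k·w³). -/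
theorem stmt_13 (v k δ lam : ℝ) (hδ : δ ≠ 0) (hk : k ≠ 0)
    (hEd : k * lam + 1 = 0) (w : ℝ) (hw : w = Real.sqrt (v ^ 2 + δ ^ 2))
    (g₁₁ g₁₂ g₂₂ h₁₁ h₁₂ h₂₂ : ℝ)
    (hg₁₁ : g₁₁ = v ^ 2 + δ ^ 2 * (lam ^ 2 + 1)) (hg₁₂ : g₁₂ = δ * lam)
    (hg₂₂ : g₂₂ = 1)
    (hh₁₁ : h₁₁ = -(k * v ^ 2 + δ ^ 2 * (k - lam)) / w) (hh₁₂ : h₁₂ = δ / w)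
    (hh₂₂ : h₂₂ = 0) (κ : ℝ) :
    (h₁₁ - κ * g₁₁) * (h₂₂ - κ * g₂₂) - (h₁₂ - κ * g₁₂) ^ 2 = 0 ↔
      κ = -k / w ∨ κ = δ ^ 2 / (k * w ^ 3) := by
  have hpos : 0 < v ^ 2 + δ ^ 2 := by positivity
  have hw0 : w ≠ 0 := by rw [hw]; exact (Real.sqrt_pos.2 hpos).ne'
  have hv : v ^ 2 = w ^ 2 - δ ^ 2 := by rw [hw, Real.sq_sqrt hpos.le]; ring
  have hlam : lam = -1 / k := by field_simp; linarith
  have hfactor : (h₁₁ - κ * g₁₁) * (h₂₂ - κ * g₂₂) - (h₁₂ - κ * g₁₂) ^ 2 =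
      w ^ 2 * ((κ - -k / w) * (κ - δ ^ 2 / (k * w ^ 3))) := by
    rw [hg₁₁, hg₁₂, hg₂₂, hh₁₁, hh₁₂, hh₂₂, hv, hlam]
    field_simp
    ring
  rw [hfactor, mul_eq_zero, mul_eq_zero, sub_eq_zero, sub_eq_zero]
  exact or_iff_right (pow_ne_zero 2 hw0)
end

section
/- Let k, δ, δ', λ be real numbers with δ ≠ 0. For v ∈ ℝ set w = Real.sqrt (v² + δ²), g₁₁ = v² + δ²·(λ²+1), g₁₂ = δ·λ, h₁₁ = −(k·v² + δ'·v + δ²·(k−λ))/w, h₁₂ = δ/w. Then (for every v ∈ ℝ, g₁₁·h₁₂ − g₁₂·h₁₁ = 0) if and only if (δ' = 0 and k·λ + 1 = 0). -/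
/-- The principal-direction expression of the curves `v = constant` is a quadratic polynomial
in `v`, up to the factor `δ / w`. -/
theorem principal_expr_eq (k δ δ' lam v w : ℝ) :
    (v ^ 2 + δ ^ 2 * (lam ^ 2 + 1)) * (δ / w)
        - (δ * lam) * (-(k * v ^ 2 + δ' * v + δ ^ 2 * (k - lam)) / w)
      = δ / w * ((k * lam + 1) * (v ^ 2 + δ ^ 2) + lam * δ' * v) := by
  ring

theorem stmt_14 (k δ δ' lam : ℝ) (hδ : δ ≠ 0) :
    (∀ v : ℝ,
      (v ^ 2 + δ ^ 2 * (lam ^ 2 + 1)) * (δ / Real.sqrt (v ^ 2 + δ ^ 2))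
        - (δ * lam) * (-(k * v ^ 2 + δ' * v + δ ^ 2 * (k - lam))
            / Real.sqrt (v ^ 2 + δ ^ 2)) = 0)
    ↔ (δ' = 0 ∧ k * lam + 1 = 0) := by
  simp only [principal_expr_eq]
  constructor
  · intro h
    have hquad (v : ℝ) : (k * lam + 1) * (v ^ 2 + δ ^ 2) + lam * δ' * v = 0 := by
      have hw : Real.sqrt (v ^ 2 + δ ^ 2) ≠ 0 := by positivity
      exact (mul_eq_zero.mp (h v)).resolve_left (div_ne_zero hδ hw)
    have hk : k * lam + 1 = 0 := by
      have h0 : (k * lam + 1) * δ ^ 2 = 0 := by linear_combination hquad 0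
      exact (mul_eq_zero.mp h0).resolve_right (pow_ne_zero 2 hδ)
    exact ⟨by linear_combination -k * hquad 1 + (δ' + k * (1 + δ ^ 2)) * hk, hk⟩
  · rintro ⟨rfl, hk⟩ v
    simp [hk]
end

section
/- Let n be an integer with n ≤ −2 and let k, δ, δ', λ, f be real numbers with δ ≠ 0 and f ≠ 0. Then it is not the case that for every v ∈ ℝ, with w = Real.sqrt (v² + δ²), the identity f·w^(n+1)·(v² + δ²·(λ²+1)) + k·v² + δ'·v + δ²·(k−λ) = 0 holds. -/
open Polynomial in
/-- If `f (x² + c a²) + (k x² - c a) x ^ p` with `c ≠ 0` and `p ≥ 1` vanishes for all large `x`,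
then `f = 0`. -/
theorem eq_zero_of_forall_ge_trinomial {p : ℕ} (hp : 1 ≤ p) {f k c a b : ℝ} (hc : c ≠ 0)
    (h : ∀ x : ℝ, b ≤ x → f * (x ^ 2 + c * a ^ 2) + (k * x ^ 2 - c * a) * x ^ p = 0) :
    f = 0 := by
  set P : ℝ[X] := C f * X ^ 2 + C (f * c * a ^ 2) + C k * X ^ (p + 2) - C (c * a) * X ^ p with hP
  have hzero : P = 0 := by
    refine Polynomial.eq_zero_of_infinite_isRoot P ((Set.Ici_infinite b).mono fun x hx => ?_)
    have hx' := h x hx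
    simp only [Set.mem_ofPred_eq, IsRoot, hP, eval_add, eval_sub, eval_mul, eval_C, eval_pow, eval_X]
    linear_combination hx'
  have h2 : P.coeff 2 = 0 := by rw [hzero, coeff_zero]
  have h0 : P.coeff 0 = 0 := by rw [hzero, coeff_zero]
  simp only [hP, coeff_add, coeff_sub, coeff_C_mul, coeff_X_pow, coeff_C] at h2 h0
  have hp0 : 0 ≠ p := by omega
  have hp0' : p ≠ 0 := hp0.symm
  by_cases h2p : 2 = p
  · by_contra hf
    have ha : a = 0 := by simpa [hp0, hf, hc] using h0
    exact hf (by simpa [hp0', ha] using h2)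
  · simpa [hp0', h2p] using h2

theorem stmt_17 (n : ℤ) (hn : n ≤ -2) (k δ δ' lam f : ℝ) (hδ : δ ≠ 0)
    (hf : f ≠ 0) :
    ¬ ∀ v : ℝ,
      f * Real.sqrt (v ^ 2 + δ ^ 2) ^ (n + 1) * (v ^ 2 + δ ^ 2 * (lam ^ 2 + 1))
        + k * v ^ 2 + δ' * v + δ ^ 2 * (k - lam) = 0 := by
  intro h
  obtain ⟨p, hp⟩ : ∃ p : ℕ, n + 1 = -(p : ℤ) := ⟨(-(n + 1)).toNat, by omega⟩
  refine hf (eq_zero_of_forall_ge_trinomial (p := p) (by omega) (pow_ne_zero 2 hδ)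
    (k := k) (a := lam) (b := |δ|) fun x hx => ?_)
  have hx0 : 0 < x := (abs_pos.mpr hδ).trans_le hx
  have hv : √(x ^ 2 - δ ^ 2) ^ 2 = x ^ 2 - δ ^ 2 :=
    Real.sq_sqrt (sub_nonneg.mpr (sq_le_sq.mpr (hx.trans (le_abs_self x))))
  have h₁ := h √(x ^ 2 - δ ^ 2)
  have h₂ := h (-√(x ^ 2 - δ ^ 2))
  rw [neg_sq] at h₂
  rw [hv, sub_add_cancel, Real.sqrt_sq hx0.le, hp, zpow_neg, zpow_natCast] at h₁ h₂
  have hxp : (x ^ p)⁻¹ * x ^ p = 1 := inv_mul_cancel₀ (pow_ne_zero p hx0.ne')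
  linear_combination x ^ p / 2 * (h₁ + h₂) - f * (x ^ 2 + δ ^ 2 * lam ^ 2) * hxp
end

section
/- Let k, δ, δ', λ, f be real numbers with δ ≠ 0, f ≠ 0 and λ ≠ 0. Suppose that for every v ∈ ℝ the identity f·(v² + δ²·(λ²+1)) + δ²·λ·((k·λ+2)·v² + δ'·λ·v + δ²·(λ² + k·λ + 2)) = 0 holds. Then δ' = 0, k·λ + 1 = 0 and f = −δ²·λ. -/
theorem stmt_18 (k δ δ' lam f : ℝ) (hδ : δ ≠ 0) (hf : f ≠ 0) (hlam : lam ≠ 0)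
    (h : ∀ v : ℝ,
      f * (v ^ 2 + δ ^ 2 * (lam ^ 2 + 1))
        + δ ^ 2 * lam * ((k * lam + 2) * v ^ 2 + δ' * lam * v
            + δ ^ 2 * (lam ^ 2 + k * lam + 2)) = 0) :
    δ' = 0 ∧ k * lam + 1 = 0 ∧ f = -δ ^ 2 * lam := by
  have h0 := h 0
  have h1 := h 1
  have h2 := h (-1)
  have h_quad : f = -δ ^ 2 * lam * (k * lam + 2) := by
    linear_combination (h1 + h2 - 2 * h0) / 2
  have h_lin : δ ^ 2 * lam ^ 2 * δ' = 0 := by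
    linear_combination (h1 - h2) / 2
  have h_const : δ ^ 4 * lam ^ 3 * (k * lam + 1) = 0 := by
    linear_combination -h0 + δ ^ 2 * (lam ^ 2 + 1) * h_quad
  have hk : k * lam + 1 = 0 := by
    simpa [hδ, hlam] using h_const
  refine ⟨by simpa [hδ, hlam] using h_lin, hk, ?_⟩
  linear_combination h_quad - δ ^ 2 * lam * hk
end

section
/- Let k, δ, δ', λ, f be real numbers with δ ≠ 0 and f ≠ 0. Suppose that for every v ∈ ℝ the identity f·((4δ² + δ'²)·v⁴ + 4δ²·δ'·λ·v³ + 2δ²·(2δ²·(λ²+1) − δ'²)·v² − 4δ⁴·δ'·λ·v + δ⁴·δ'²) + 4δ²·v·(k·v³ + δ²·(k−λ)·v + δ²·δ') = 0 holds. Then f = −k, δ' = 0 and λ·(k·λ + 1) = 0. -/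
theorem stmt_19 (k δ δ' lam f : ℝ) (hδ : δ ≠ 0) (hf : f ≠ 0)
    (h : ∀ v : ℝ,
      f * ((4 * δ ^ 2 + δ' ^ 2) * v ^ 4 + 4 * δ ^ 2 * δ' * lam * v ^ 3
          + 2 * δ ^ 2 * (2 * δ ^ 2 * (lam ^ 2 + 1) - δ' ^ 2) * v ^ 2
          - 4 * δ ^ 4 * δ' * lam * v + δ ^ 4 * δ' ^ 2)
        + 4 * δ ^ 2 * v * (k * v ^ 3 + δ ^ 2 * (k - lam) * v + δ ^ 2 * δ') = 0) :
    f = -k ∧ δ' = 0 ∧ lam * (k * lam + 1) = 0 := by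
  have hδ' : δ' = 0 := by simpa [hf, hδ] using h 0
  subst hδ'
  have h₁ := h 1
  have h₂ := h 2
  have hfk : f = -k := by
    have : δ ^ 2 * (f + k) = 0 := by linear_combination (h₂ - 4 * h₁) / 48
    have := (mul_eq_zero.mp this).resolve_left (pow_ne_zero 2 hδ)
    linarith
  refine ⟨hfk, rfl, ?_⟩
  subst hfk
  have : δ ^ 4 * (lam * (k * lam + 1)) = 0 := by linear_combination -h₁ / 4
  exact (mul_eq_zero.mp this).resolve_left (pow_ne_zero 4 hδ)
end
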